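/- arXiv:2010.13390 — 3 statements merged into one kernel-verified Lean document; each statement's English description precedes it below -/
import Mathlib

section
/- If M is a free R-module of rank 1 (where R = ℤ_(p) C_p) and L is an R-submodule of M with pM ⊆ L ⊆ M such that L is also a free R-module, then L = M or L = pM. -/
open scoped BigOperators

set_option synthInstance.maxHeartbeats 1000000
set_option maxHeartbeats 1000000

def Zsub (p : ℕ) [Fact p.Prime] : Subring ℚ where
  carrier := {x : ℚ | ¬ (p ∣ x.den)}
  zero_mem' := by simp [Nat.Prime.ne_one (Fact.out (p := p.Prime))]
  one_mem' := by simp [Nat.Prime.ne_one (Fact.out (p := p.Prime))]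
  add_mem' := by
    intro a b ha hb hd
    rcases (Nat.Prime.dvd_mul (Fact.out (p := p.Prime))).1
      (hd.trans (Rat.add_den_dvd a b)) with h | h
    exacts [ha h, hb h]
  mul_mem' := by
    intro a b ha hb hd
    rcases (Nat.Prime.dvd_mul (Fact.out (p := p.Prime))).1
      (hd.trans (Rat.mul_den_dvd a b)) with h | h
    exacts [ha h, hb h]
  neg_mem' := by intro a ha; simpa using ha

abbrev Cp (p : ℕ) := Multiplicative (ZMod p)

def sigmaGen (p : ℕ) : Cp p := Multiplicative.ofAdd (1 : ZMod p)


/-- The group ring `R = ℤ_(p) C_p`. -/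
abbrev Rgrp (p : ℕ) [Fact p.Prime] := MonoidAlgebra (Zsub p) (Cp p)


theorem Zsub_unit (p : ℕ) [Fact p.Prime] (a b : Zsub p) (h : ¬ (p : ℤ) ∣ (a : ℚ).num) :
    IsUnit a := by
  have ha0 : (a : ℚ) ≠ 0 := by
    intro h0
    rw [h0] at h
    simp at h
  have hm : (a : ℚ)⁻¹ ∈ Zsub p := by
    change ¬ (p ∣ ((a : ℚ)⁻¹).den)
    rw [Rat.den_inv_of_ne_zero ha0]
    rwa [← Int.natCast_dvd]
  refine IsUnit.of_mul_eq_one ⟨_, hm⟩ ?_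
  apply Subtype.ext
  exact mul_inv_cancel₀ ha0

theorem Zsub_irr (p : ℕ) [Fact p.Prime] (a b : Zsub p) (h : (p : Zsub p) = a * b) :
    IsUnit a ∨ IsUnit b := by
  by_contra! hc
  have h1 : (p : ℤ) ∣ (a : ℚ).num := by
    by_contra h1
    exact hc.1 (Zsub_unit p a b h1)
  have h2 : (p : ℤ) ∣ (b : ℚ).num := by
    by_contra h1
    exact hc.2 (Zsub_unit p b a h1)
  have hpp : p.Prime := Fact.out
  have hq : (p : ℚ) = (a : ℚ) * (b : ℚ) := by
    have := congrArg (Subtype.val) h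
    simpa using this
  have hz : (p : ℤ) * ((a : ℚ).den * (b : ℚ).den) = (a : ℚ).num * (b : ℚ).num := by
    have ha := Rat.mul_den_eq_num (a : ℚ)
    have hb := Rat.mul_den_eq_num (b : ℚ)
    have : (p : ℚ) * ((a : ℚ).den * (b : ℚ).den) = (a : ℚ).num * (b : ℚ).num := by
      rw [← ha, ← hb, hq]; ring
    exact_mod_cast this
  obtain ⟨u, hu⟩ := h1
  obtain ⟨v, hv⟩ := h2
  rw [hu, hv] at hz
  have hp0 : (p : ℤ) ≠ 0 := by exact_mod_cast hpp.ne_zero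
  have h3 : (((a : ℚ).den * (b : ℚ).den : ℕ) : ℤ) = p * (u * v) := by
    apply mul_left_cancel₀ hp0
    push_cast
    rw [hz]; ring
  have h4 : p ∣ (a : ℚ).den * (b : ℚ).den := by
    rw [← Int.natCast_dvd_natCast, h3]
    exact dvd_mul_right _ _
  rcases hpp.dvd_mul.1 h4 with h | h
  · exact a.2 h
  · exact b.2 h

noncomputable def augm (p : ℕ) [Fact p.Prime] : Rgrp p →ₐ[Zsub p] Zsub p :=
  MonoidAlgebra.lift (Zsub p) (Zsub p) (Cp p) 1

theorem Cp_pow (p : ℕ) [Fact p.Prime] (g : Cp p) : g ^ p = 1 := by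
  apply Multiplicative.toAdd.injective
  simp

theorem frob_aug (p : ℕ) [Fact p.Prime] (x : Rgrp p) :
    (p : Rgrp p) ∣ x ^ p - algebraMap (Zsub p) (Rgrp p) (augm p x ^ p) := by
  have hpp : p.Prime := Fact.out
  induction x using MonoidAlgebra.induction_linear with
  | zero => simp [hpp.ne_zero]
  | add f g hf hg =>
    obtain ⟨r, hr⟩ := exists_add_pow_prime_eq hpp f g
    obtain ⟨s, hs⟩ := exists_add_pow_prime_eq hpp (augm p f) (augm p g)
    rw [map_add, hr, hs]
    obtain ⟨u, hu⟩ := hf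
    obtain ⟨v, hv⟩ := hg
    simp only [map_add, map_mul, map_natCast]
    refine ⟨u + v + f * g * r - algebraMap (Zsub p) (Rgrp p) (augm p f) * algebraMap (Zsub p) (Rgrp p) (augm p g) * algebraMap (Zsub p) (Rgrp p) s, ?_⟩
    linear_combination hu + hv
  | single g a =>
    have : MonoidAlgebra.single g a ^ p = algebraMap (Zsub p) (Rgrp p) (augm p (MonoidAlgebra.single g a) ^ p) := by
      rw [MonoidAlgebra.single_pow, Cp_pow]
      simp [augm]
    rw [this, sub_self]
    exact dvd_zero _

theorem unit_of_aug (p : ℕ) [Fact p.Prime] (x y : Rgrp p) (h : (p : Rgrp p) = x * y)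
    (hx : IsUnit (augm p x)) : IsUnit x := by
  have hpp : p.Prime := Fact.out
  have hu : IsUnit (algebraMap (Zsub p) (Rgrp p) (augm p x ^ p)) := (hx.pow p).map _
  refine isUnit_of_dvd_unit ?_ hu
  have h1 : x ∣ x ^ p - algebraMap (Zsub p) (Rgrp p) (augm p x ^ p) :=
    (Dvd.intro y h.symm).trans (frob_aug p x)
  exact (dvd_sub_right (dvd_pow_self x hpp.ne_zero)).1 h1

theorem irr_R (p : ℕ) [Fact p.Prime] (x y : Rgrp p) (h : (p : Rgrp p) = x * y) :
    IsUnit x ∨ IsUnit y := by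
  have h1 : (p : Zsub p) = augm p x * augm p y := by
    rw [← map_mul, ← h, map_natCast]
  rcases Zsub_irr p _ _ h1 with h2 | h2
  · exact Or.inl (unit_of_aug p x y h h2)
  · exact Or.inr (unit_of_aug p y x (by rw [h, mul_comm]) h2)

theorem principal_of_free {A : Type*} [CommRing A] [Nontrivial A] (I : Ideal A)
    (h : Module.Free A I) : ∃ x, I = Ideal.span {x} := by
  obtain ⟨ι, b⟩ := h.exists_basis
  have hs : Subsingleton ι := by
    refine ⟨fun i j => ?_⟩
    by_contra hij
    have he : (b j : A) • b i = (b i : A) • b j := by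
      apply Subtype.ext
      simp [mul_comm]
    have h2 := congrArg (fun z => b.repr z i) he
    simp [Finsupp.single_apply, Ne.symm hij] at h2
    exact b.ne_zero j h2
  rcases isEmpty_or_nonempty ι with hι | ⟨⟨i⟩⟩
  · refine ⟨0, ?_⟩
    have : Subsingleton I := b.repr.toEquiv.subsingleton
    rw [Ideal.span_singleton_zero]
    exact Submodule.subsingleton_iff_eq_bot.1 this
  · refine ⟨b i, ?_⟩
    apply le_antisymm
    · intro z hz
      have : Fintype ι := Fintype.ofFinite ι
      rw [Ideal.mem_span_singleton']
      refine ⟨b.repr ⟨z, hz⟩ i, ?_⟩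
      have h3 := b.sum_repr ⟨z, hz⟩
      rw [Fintype.sum_subsingleton _ i] at h3
      simpa using congrArg Subtype.val h3
    · rw [Ideal.span_singleton_le_iff_mem]
      exact (b i).2

/-- If `M` is a free module of rank `1` over `R = ℤ_(p) C_p` and
`L` is an `R`-submodule of `M` with `pM ⊆ L ⊆ M` such that `L` is itself a free
`R`-module, then `L = M` or `L = pM`. -/
theorem stmt6 (p : ℕ) [Fact p.Prime]
    (M : Type*) [AddCommGroup M] [Module (Rgrp p) M]
    (hM : Nonempty (M ≃ₗ[Rgrp p] Rgrp p))
    (L : Submodule (Rgrp p) M)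
    (hpL : Ideal.span {(p : Rgrp p)} • (⊤ : Submodule (Rgrp p) M) ≤ L)
    (hLfree : Module.Free (Rgrp p) L) :
    L = ⊤ ∨ L = Ideal.span {(p : Rgrp p)} • (⊤ : Submodule (Rgrp p) M) := by
  obtain ⟨e⟩ := hM
  have hI : Module.Free (Rgrp p) (L.map e.toLinearMap) :=
    Module.Free.of_equiv (e.submoduleMap L)
  obtain ⟨x, hx⟩ := principal_of_free (L.map e.toLinearMap) hI
  have hP : (Ideal.span {(p : Rgrp p)} • (⊤ : Submodule (Rgrp p) M)).map e.toLinearMap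
      = Ideal.span {(p : Rgrp p)} := by
    rw [Submodule.map_smul'', Submodule.map_top, LinearEquiv.range, smul_eq_mul, Ideal.mul_top]
  have hinj := Submodule.map_injective_of_injective (f := e.toLinearMap) e.injective
  have hle := Submodule.map_mono (f := e.toLinearMap) hpL
  rw [hP, hx] at hle
  obtain ⟨y, hy⟩ := Ideal.span_singleton_le_span_singleton.1 hle
  rcases irr_R p x y hy with h | h
  · left
    apply hinj
    rw [hx, Submodule.map_top, LinearEquiv.range]
    exact Ideal.span_singleton_eq_top.2 h
  · right
    apply hinj
    rw [hx, hP, hy]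
    exact (Ideal.span_singleton_mul_right_unit h x).symm
end

section
/- Let M ≅ R ⊕ S be the direct sum of a free rank-1 R-module with basis element x and a trivial module S = Re₁ with generator y, for p > 2. Let L be the R-submodule generated by p·x·e₁ and x·(1-σ) + y. Then L ≅ S ⊕ R as R-modules, pM ⊆ L ⊆ M, and the index [M : L] = p², so L and M do not admit a compatible pseudo-basis of the form in the elementary divisor theorem. -/
open scoped BigOperators

set_option synthInstance.maxHeartbeats 1000000
set_option maxHeartbeats 1000000

/-- `σ` as an element of the group ring. -/
noncomputable def sigmaEl (p : ℕ) [Fact p.Prime] : Rgrp p :=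
  MonoidAlgebra.of (Zsub p) (Cp p) (sigmaGen p)

/-- The norm element `1 + σ + ⋯ + σ^{p-1} = p·e₁` of the group ring. -/
noncomputable def normEl (p : ℕ) [Fact p.Prime] : Rgrp p :=
  ∑ g : Cp p, MonoidAlgebra.of (Zsub p) (Cp p) g

namespace Stmt9Aux

lemma fst_ne (p : ℕ) [Fact p.Prime] (a : Zsub p) : ((a : ℚ).den : ZMod p) ≠ 0 := by
  intro h
  exact a.2 ((ZMod.natCast_eq_zero_iff _ _).1 h)

/-- residue map -/
noncomputable def res (p : ℕ) [Fact p.Prime] : Zsub p →+* ZMod p where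
  toFun a := ((a : ℚ) : ZMod p)
  map_one' := by simp
  map_zero' := by simp
  map_add' a b := by
    simpa using Rat.cast_add_of_ne_zero (fst_ne p a) (fst_ne p b)
  map_mul' a b := by
    simpa using Rat.cast_mul_of_ne_zero (fst_ne p a) (fst_ne p b)

lemma res_eq_zero (p : ℕ) [Fact p.Prime] (a : Zsub p) (h : res p a = 0) :
    ∃ c : Zsub p, a = p * c := by
  have h' : ((a : ℚ) : ZMod p) = 0 := h
  rw [Rat.cast_def, div_eq_zero_iff] at h'
  have h2 : ((a : ℚ).num : ZMod p) = 0 := h'.resolve_right (fst_ne p a)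
  obtain ⟨k, hk⟩ := (ZMod.intCast_zmod_eq_zero_iff_dvd _ _).1 h2 
  have hd : (((a : ℚ).den : ℚ)⁻¹) ∈ Zsub p := by
    change ¬ (p ∣ _)
    rw [Rat.inv_natCast_den_of_pos (a : ℚ).den_pos]
    exact a.2
  refine ⟨(k : Zsub p) * ⟨_, hd⟩, ?_⟩
  apply Subtype.ext
  push_cast
  conv_lhs => rw [← Rat.num_div_den (a : ℚ), hk]
  push_cast
  rw [div_eq_mul_inv, mul_assoc]

/-- augmentation -/
noncomputable def aug (p : ℕ) [Fact p.Prime] : Rgrp p →+* Zsub p :=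
  MonoidAlgebra.liftNCRingHom (RingHom.id _) (1 : Cp p →* Zsub p) (fun _ _ => Commute.all _ _)

noncomputable def expHom (p : ℕ) [Fact p.Prime] : Cp p →* DualNumber (ZMod p) where
  toFun g := TrivSqZeroExt.inl 1 + TrivSqZeroExt.inr (-(Multiplicative.toAdd g))
  map_one' := by ext <;> simp
  map_mul' a b := by ext <;> simp 

noncomputable def psi (p : ℕ) [Fact p.Prime] : Rgrp p →+* DualNumber (ZMod p) :=
  MonoidAlgebra.liftNCRingHom ((algebraMap (ZMod p) (DualNumber (ZMod p))).comp (res p))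
    (expHom p) (fun _ _ => Commute.all _ _)

variable (p : ℕ) [Fact p.Prime]

lemma aug_single (g : Cp p) (c : Zsub p) : aug p (MonoidAlgebra.single g c) = c := by
  simp [aug]

lemma psi_single (g : Cp p) (c : Zsub p) : psi p (MonoidAlgebra.single g c) =
    algebraMap (ZMod p) (DualNumber (ZMod p)) (res p c) * expHom p g := by
  simp [psi]

lemma fst_psi (r : Rgrp p) : (psi p r).fst = res p (aug p r) := by
  induction r using MonoidAlgebra.induction_linear with
  | zero => simp
  | add f g hf hg => simp [hf, hg]
  | single g c => rw [psi_single, aug_single]; simp [expHom, TrivSqZeroExt.algebraMap_eq_inl]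

lemma psi_t : psi p (1 - sigmaEl p) = DualNumber.eps := by
  rw [map_sub, map_one, sigmaEl, MonoidAlgebra.of_apply, psi_single]
  ext <;> simp [expHom, sigmaGen]

lemma aug_t : aug p (1 - sigmaEl p) = 0 := by
  rw [map_sub, map_one, sigmaEl, MonoidAlgebra.of_apply, aug_single, sub_self]

lemma aug_N : aug p (normEl p) = p := by
  rw [normEl, map_sum]
  simp [MonoidAlgebra.of_apply, aug_single, ZMod.card]

lemma sum_zero (hp2 : 2 < p) : ∑ k : ZMod p, k = 0 := by
  have h : ∑ k : ZMod p, k = ∑ k : ZMod p, -k := (Equiv.sum_comp (Equiv.neg (ZMod p)) id).symm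
  rw [Finset.sum_neg_distrib] at h
  have h2 : (2 : ZMod p) * ∑ k : ZMod p, k = 0 := by linear_combination h
  refine (mul_eq_zero.1 h2).resolve_left ?_
  intro h3
  have : ((2 : ℕ) : ZMod p) = 0 := by exact_mod_cast h3
  exact absurd (Nat.le_of_dvd (by norm_num) ((ZMod.natCast_eq_zero_iff _ _).1 this)) (by omega)

lemma psi_N (hp2 : 2 < p) : psi p (normEl p) = 0 := by
  have h2 : ∑ g : Cp p, Multiplicative.toAdd g = (0 : ZMod p) :=
    (Equiv.sum_comp (Multiplicative.toAdd (α := ZMod p)) id).trans (sum_zero p hp2)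
  ext
  · rw [fst_psi, aug_N]; simp
  · rw [normEl, map_sum]
    simp [MonoidAlgebra.of_apply, psi_single, expHom, TrivSqZeroExt.snd_sum, h2]

lemma mul_N (r : Rgrp p) : r * normEl p = MonoidAlgebra.single 1 (aug p r) * normEl p := by
  induction r using MonoidAlgebra.induction_linear with
  | zero => simp
  | add f g hf hg => rw [add_mul, hf, hg, map_add, MonoidAlgebra.single_add, add_mul]
  | single g c =>
    rw [aug_single, normEl, Finset.mul_sum, Finset.mul_sum]
    simp only [MonoidAlgebra.of_apply, MonoidAlgebra.single_mul_single, one_mul, mul_one]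
    exact Equiv.sum_comp (Equiv.mulLeft g) (fun h => (MonoidAlgebra.single h c : Rgrp p))

lemma of_sub_one (g : Cp p) : (1 - sigmaEl p) ∣ 1 - MonoidAlgebra.single g (1 : Zsub p) := by
  have : (MonoidAlgebra.single g (1 : Zsub p) : Rgrp p) =
      sigmaEl p ^ (ZMod.val (Multiplicative.toAdd g)) := by
    rw [sigmaEl, ← map_pow, MonoidAlgebra.of_apply]
    congr 1
    rw [sigmaGen, ← ofAdd_nsmul]
    simp
  rw [this]
  exact one_sub_dvd_one_sub_pow _ _

lemma sub_aug (r : Rgrp p) : (1 - sigmaEl p) ∣ MonoidAlgebra.single 1 (aug p r) - r := by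
  induction r using MonoidAlgebra.induction_linear with
  | zero => simp
  | add f g hf hg =>
    rw [map_add, MonoidAlgebra.single_add, add_sub_add_comm]
    exact dvd_add hf hg
  | single g c =>
    rw [aug_single]
    have h := (of_sub_one p g).mul_left (MonoidAlgebra.single 1 c)
    rwa [mul_sub, mul_one, MonoidAlgebra.single_mul_single, one_mul, mul_one] at h

lemma dvd_of_aug (r : Rgrp p) (h : aug p r = 0) : (1 - sigmaEl p) ∣ r := by
  have := sub_aug p r
  rw [h, MonoidAlgebra.single_zero, zero_sub] at this
  obtain ⟨w, hw⟩ := this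
  exact ⟨-w, by linear_combination -hw⟩

lemma t_N : (1 - sigmaEl p) * normEl p = 0 := by
  rw [mul_N, aug_t]; simp

lemma p_ne : (p : Zsub p) ≠ 0 := by
  intro h
  have h2 := congrArg (Subtype.val) h
  push_cast at h2
  exact (Fact.out (p := p.Prime)).ne_zero (by exact_mod_cast h2)

lemma N_inj (k : Rgrp p) (h : aug p (k * normEl p) = 0) : aug p k = 0 := by
  rw [map_mul, aug_N] at h
  exact (mul_eq_zero.1 h).resolve_right (p_ne p)

lemma ann_t (r : Rgrp p) (h : r * (1 - sigmaEl p) = 0) : ∃ k, r = k * normEl p := by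
  have h1 : sigmaEl p * r = r := by linear_combination -h
  have h2 : ∀ g : Cp p, MonoidAlgebra.single g (1 : Zsub p) * r = r := by
    intro g
    obtain ⟨w, hw⟩ := of_sub_one p g
    linear_combination -r * hw - w * h
  refine ⟨MonoidAlgebra.single 1 (r.coeff 1), ?_⟩
  ext g
  have h3 : r.coeff g = r.coeff 1 := by
    have := congrArg (fun z : Rgrp p => z.coeff g) (h2 g)
    simp only [MonoidAlgebra.coeff_single_mul_apply] at this
    simpa using this.symm
  rw [normEl, Finset.mul_sum]
  simp [MonoidAlgebra.of_apply, h3, MonoidAlgebra.single_mul_single, Finsupp.single_apply]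

lemma ker_psi (hp2 : 2 < p) (r : Rgrp p) (h : psi p r = 0) :
    ∃ c v, r = c * normEl p + (1 - sigmaEl p) ^ 2 * v := by
  have key : ∀ r : Rgrp p, (psi p r).fst = 0 →
      ∃ c w, r = c * normEl p + (1 - sigmaEl p) * w := by
    intro r h
    rw [fst_psi] at h
    obtain ⟨c, hc⟩ := res_eq_zero p _ h
    obtain ⟨w, hw⟩ := dvd_of_aug p (r - MonoidAlgebra.single 1 c * normEl p) (by
      rw [map_sub, map_mul, aug_single, aug_N, hc]; ring)
    exact ⟨MonoidAlgebra.single 1 c, w, by linear_combination hw⟩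
  obtain ⟨c, w, hw⟩ := key r (by rw [h]; simp)
  rw [hw, map_add, map_mul, psi_N p hp2, map_mul, psi_t, mul_zero, zero_add] at h
  have h1 : (psi p w).fst = 0 := by
    have := congrArg TrivSqZeroExt.snd h
    simpa using this
  obtain ⟨d, v, hv⟩ := key w h1
  exact ⟨c, v, by rw [hw, hv]; linear_combination d * t_N p⟩

lemma psi_surj : Function.Surjective (psi p) := by
  intro z
  refine ⟨(z.fst.val : Rgrp p) + (z.snd.val : Rgrp p) * (1 - sigmaEl p), ?_⟩
  rw [map_add, map_mul, psi_t, map_natCast, map_natCast]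
  ext <;> simp [-ZMod.natCast_val] <;> exact ZMod.natCast_zmod_val _

end Stmt9Aux

namespace Stmt9Aux

section abstract
variable {R M : Type*} [CommRing R] [AddCommGroup M] [Module R M]

lemma exists_coord {x y : M} (hsup : Submodule.span R {x} ⊔ Submodule.span R {y} = ⊤) (m : M) :
    ∃ a b : R, m = a • x + b • y := by
  have : m ∈ Submodule.span R {x} ⊔ Submodule.span R {y} := by rw [hsup]; trivial
  obtain ⟨u, hu, v, hv, rfl⟩ := Submodule.mem_sup.1 this
  obtain ⟨a, rfl⟩ := Submodule.mem_span_singleton.1 hu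
  obtain ⟨b, rfl⟩ := Submodule.mem_span_singleton.1 hv
  exact ⟨a, b, rfl⟩

lemma indep {x y : M} (hinf : Submodule.span R {x} ⊓ Submodule.span R {y} = ⊥) {a b : R}
    (h : a • x + b • y = 0) : a • x = 0 ∧ b • y = 0 := by
  have h1 : a • x ∈ Submodule.span R {x} ⊓ Submodule.span R {y} := by
    refine ⟨Submodule.mem_span_singleton.2 ⟨a, rfl⟩, Submodule.mem_span_singleton.2 ⟨-b, ?_⟩⟩
    rw [neg_smul]; exact (eq_neg_of_add_eq_zero_left h).symm
  rw [hinf, Submodule.mem_bot] at h1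
  exact ⟨h1, by rwa [h1, zero_add] at h⟩

lemma free {x : M} (hx : LinearMap.ker (LinearMap.toSpanSingleton R M x) = ⊥) {a : R}
    (h : a • x = 0) : a = 0 := by
  have : a ∈ LinearMap.ker (LinearMap.toSpanSingleton R M x) := by simpa using h
  rwa [hx, Submodule.mem_bot] at this

lemma tors {y : M} {t : R} (hy : LinearMap.ker (LinearMap.toSpanSingleton R M y) = Ideal.span {t})
    {a : R} : a • y = 0 ↔ t ∣ a := by
  have : a ∈ LinearMap.ker (LinearMap.toSpanSingleton R M y) ↔ a • y = 0 := by simp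
  rw [← this, hy, Ideal.mem_span_singleton]

theorem main (p : ℕ) [Fact p.Prime] (t N : R) (psi : R →+* DualNumber (ZMod p))
    (tN : t * N = 0) (ann_t : ∀ r, r * t = 0 → ∃ k, r = k * N)
    (N_inj : ∀ k, t ∣ k * N → t ∣ k)
    (ker_psi : ∀ r, psi r = 0 → ∃ c v, r = c * N + t ^ 2 * v)
    (psi_N : psi N = 0) (psi_t : psi t = DualNumber.eps)
    (psi_surj : Function.Surjective psi) (x y : M)
    (hx : LinearMap.ker (LinearMap.toSpanSingleton R M x) = ⊥)
    (hy : LinearMap.ker (LinearMap.toSpanSingleton R M y) = Ideal.span {t})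
    (hsup : Submodule.span R {x} ⊔ Submodule.span R {y} = ⊤)
    (hinf : Submodule.span R {x} ⊓ Submodule.span R {y} = ⊥)
    (L : Submodule R M)
    (hL : L = Submodule.span R {N • x, t • x + y}) :
    Nonempty (L ≃ₗ[R] (R ⧸ Ideal.span {t}) × R) ∧
    Ideal.span {(p : R)} • (⊤ : Submodule R M) ≤ L ∧
    Nat.card (M ⧸ L) = p ^ 2 ∧
    ¬ ∃ (x' y' : M) (I J : Ideal R),
        LinearMap.ker (LinearMap.toSpanSingleton R M x') = ⊥ ∧
        LinearMap.ker (LinearMap.toSpanSingleton R M y') = Ideal.span {t} ∧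
        Submodule.span R {x'} ⊔ Submodule.span R {y'} = ⊤ ∧
        Submodule.span R {x'} ⊓ Submodule.span R {y'} = ⊥ ∧
        L = I • Submodule.span R {x'} ⊔ J • Submodule.span R {y'} := by
  have hty : t • y = 0 := (tors hy).2 dvd_rfl
  -- coordinates are unique
  have uniq : ∀ a b c d : R, a • x + b • y = c • x + d • y → a = c ∧ t ∣ b - d := by
    intro a b c d h
    have h0 : (a - c) • x + (b - d) • y = 0 := by
      rw [sub_smul, sub_smul, sub_add_sub_comm, h, sub_self]
    obtain ⟨h1, h2⟩ := indep hinf h0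
    exact ⟨sub_eq_zero.1 (free hx h1), (tors hy).1 h2⟩
  have psi_dvd : ∀ b d : R, t ∣ b - d → DualNumber.eps * psi b = DualNumber.eps * psi d := by
    rintro b d ⟨w, hw⟩
    have hb : b = d + t * w := by linear_combination hw
    rw [hb, map_add, map_mul, psi_t, mul_add, ← mul_assoc, DualNumber.eps_mul_eps, zero_mul,
      add_zero]
  have fst_dvd : ∀ b d : R, t ∣ b - d → (psi b).fst = (psi d).fst := by
    rintro b d ⟨w, hw⟩
    have hb : b = d + t * w := by linear_combination hw
    rw [hb, map_add, map_mul, psi_t]; simp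
  -- membership in L
  have memL : ∀ a b : R, a • x + b • y ∈ L ↔ psi a = DualNumber.eps * psi b := by
    intro a b
    rw [hL, Submodule.mem_span_pair]
    constructor
    · rintro ⟨u, v, h⟩
      have h' : (u * N + v * t) • x + v • y = a • x + b • y := by
        rw [← h]; module
      obtain ⟨h1, h2⟩ := uniq _ _ _ _ h'
      rw [← h1, ← psi_dvd _ _ h2, map_add, map_mul, map_mul, psi_N, psi_t]
      ring
    · intro h
      obtain ⟨c, v, hcv⟩ := ker_psi (a - t * b) (by rw [map_sub, map_mul, psi_t, h, sub_self])
      refine ⟨c, b + t * v, ?_⟩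
      have ha : a = c * N + t ^ 2 * v + t * b := by linear_combination hcv
      have h3 : (t * v) • y = 0 := by rw [mul_comm, mul_smul, hty, smul_zero]
      calc c • N • x + (b + t * v) • (t • x + y)
          = (c * N + t ^ 2 * v + t * b) • x + b • y + (t * v) • y := by module
        _ = _ := by rw [h3, add_zero, ← ha]
  refine ⟨?_, ?_, ?_, ?_⟩
  · let f : R × R →ₗ[R] M := (LinearMap.toSpanSingleton R M (N • x)).coprod
      (LinearMap.toSpanSingleton R M (t • x + y))
    have hf : ∀ a b, f (a, b) = a • N • x + b • (t • x + y) := by intro a b; simp [f]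
    let g : R × R →ₗ[R] (R ⧸ Ideal.span {t}) × R :=
      (Submodule.mkQ (Ideal.span {t})).prodMap LinearMap.id
    have hg : Function.Surjective g := by
      rintro ⟨q, b⟩
      obtain ⟨a, rfl⟩ := Submodule.mkQ_surjective _ q
      exact ⟨(a, b), rfl⟩
    have hr : LinearMap.range f = L := by
      ext m
      rw [hL, Submodule.mem_span_pair]
      constructor
      · rintro ⟨⟨a, b⟩, h⟩; exact ⟨a, b, by rw [← h, hf]⟩
      · rintro ⟨a, b, h⟩; exact ⟨(a, b), by rw [← h, hf]⟩
    have hk : LinearMap.ker f = LinearMap.ker g := by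
      ext ⟨a, b⟩
      have e2 : (a, b) ∈ LinearMap.ker g ↔ t ∣ a ∧ b = 0 := by
        rw [LinearMap.mem_ker, ← Ideal.mem_span_singleton, ← Submodule.Quotient.mk_eq_zero]
        exact Prod.mk_eq_zero
      rw [e2, LinearMap.mem_ker, hf]
      constructor
      · intro h
        have h' : (a * N + b * t) • x + b • y = (0 : R) • x + (0 : R) • y := by
          rw [zero_smul, zero_smul, add_zero, ← h]; module
        obtain ⟨h1, h2⟩ := uniq _ _ _ _ h'
        have ha : t ∣ a := N_inj _ ⟨-b, by linear_combination h1⟩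
        refine ⟨ha, ?_⟩
        obtain ⟨w, rfl⟩ := ha
        obtain ⟨k, hk⟩ := ann_t b (by linear_combination h1 - w * tN)
        rw [sub_zero, hk] at h2
        obtain ⟨v, rfl⟩ := N_inj _ h2
        rw [hk]; linear_combination v * tN
      · rintro ⟨⟨w, rfl⟩, rfl⟩
        rw [zero_smul, add_zero, smul_smul, mul_right_comm, tN, zero_mul, zero_smul]
    exact ⟨(LinearEquiv.ofEq _ _ hr.symm).trans (f.quotKerEquivRange.symm.trans
      ((Submodule.quotEquivOfEq _ _ hk).trans (g.quotKerEquivOfSurjective hg)))⟩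
  · rw [Submodule.smul_le]
    intro r hr m _
    obtain ⟨c, rfl⟩ := Ideal.mem_span_singleton.1 hr
    obtain ⟨a, b, rfl⟩ := exists_coord hsup m
    rw [smul_add, smul_smul, smul_smul, memL]
    have hp : psi (p : R) = 0 := by
      rw [map_natCast]; ext <;> simp
    simp only [map_mul, hp, zero_mul, mul_zero]
  · let F : R × R →+ M :=
      { toFun := fun z => z.1 • x + z.2 • y
        map_zero' := by simp
        map_add' := by intro z w; simp only [Prod.fst_add, Prod.snd_add]; module }
    have hF : Function.Surjective F := by
      intro m
      obtain ⟨a, b, h⟩ := exists_coord hsup m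
      exact ⟨(a, b), h.symm⟩
    let G : R × R →+ DualNumber (ZMod p) :=
      { toFun := fun z => psi z.1 - DualNumber.eps * psi z.2
        map_zero' := by simp
        map_add' := by intro z w; simp only [Prod.fst_add, Prod.snd_add, map_add]; ring }
    have hG : Function.Surjective G := by
      intro z
      obtain ⟨a, h⟩ := psi_surj z
      exact ⟨(a, 0), by simp [G, h]⟩
    have hc : AddSubgroup.comap F L.toAddSubgroup = G.ker := by
      ext ⟨a, b⟩
      rw [AddSubgroup.mem_comap, AddMonoidHom.mem_ker]
      change a • x + b • y ∈ L ↔ psi a - DualNumber.eps * psi b = 0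
      rw [memL, sub_eq_zero]
    have h1 : Nat.card (M ⧸ L) = L.toAddSubgroup.index := rfl
    rw [h1, ← AddSubgroup.index_comap_of_surjective _ hF, hc, AddSubgroup.index_ker,
      AddMonoidHom.range_eq_top.2 hG, Nat.card_congr AddSubgroup.topEquiv.toEquiv]
    change Nat.card (ZMod p × ZMod p) = _
    rw [Nat.card_prod, Nat.card_zmod, sq]
  · rintro ⟨x', y', I, J, hx', hy', hsup', hinf', hL'⟩
    obtain ⟨a, b, hab⟩ := exists_coord hsup x'
    obtain ⟨c, d, hcd⟩ := exists_coord hsup y'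
    obtain ⟨α, β, h1⟩ := exists_coord hsup' x
    obtain ⟨γ, δ, h2⟩ := exists_coord hsup' y
    -- c is a multiple of N
    have hty' : t • y' = 0 := (tors hy').2 dvd_rfl
    have hc0 : psi c = 0 := by
      have h : (t * c) • x + (t * d) • y = (0 : R) • x + (0 : R) • y := by
        rw [zero_smul, zero_smul, add_zero, ← hty', hcd]; module
      obtain ⟨k, rfl⟩ := ann_t c (by linear_combination (uniq _ _ _ _ h).1)
      rw [map_mul, psi_N, mul_zero]
    have e1 : (1 : R) • x + (0 : R) • y = (α * a + β * c) • x + (α * b + β * d) • y := by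
      conv_lhs => rw [one_smul, zero_smul, add_zero, h1, hab, hcd]
      module
    have e2 : (0 : R) • x + (1 : R) • y = (γ * a + δ * c) • x + (γ * b + δ * d) • y := by
      conv_lhs => rw [one_smul, zero_smul, zero_add, h2, hab, hcd]
      module
    obtain ⟨e11, e12⟩ := uniq _ _ _ _ e1
    obtain ⟨e21, e22⟩ := uniq _ _ _ _ e2
    have f11 := congrArg (fun r => (psi r).fst) e11
    have f21 := congrArg (fun r => (psi r).fst) e21
    have f12 := fst_dvd _ _ e12
    have f22 := fst_dvd _ _ e22
    simp only [map_add, map_mul, map_one, map_zero, hc0, mul_zero, add_zero,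
      TrivSqZeroExt.fst_add, TrivSqZeroExt.fst_mul, TrivSqZeroExt.fst_one,
      TrivSqZeroExt.fst_zero] at f11 f21 f12 f22
    have ha : (psi a).fst ≠ 0 := by
      intro h; rw [h, mul_zero] at f11; exact one_ne_zero f11
    have hα : (psi α).fst ≠ 0 := by
      intro h; rw [h, zero_mul] at f11; exact one_ne_zero f11
    -- y' is in L
    have hyL : y' ∈ L := by
      obtain ⟨q, hq⟩ := psi_surj (TrivSqZeroExt.inl ((psi d).fst / (psi a).fst))
      have hm : y' + (t * q) • x' ∈ L := by
        have : y' + (t * q) • x' = (c + t * q * a) • x + (d + t * q * b) • y := by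
          rw [hcd, hab]; module
        rw [this, memL]
        simp only [map_add, map_mul, hc0, psi_t, hq]
        ext
        · simp
        · simp [div_eq_mul_inv, mul_assoc, inv_mul_cancel₀ ha]
      have hm' := hm
      rw [hL'] at hm'
      obtain ⟨u, hu, v, hv, huv⟩ := Submodule.mem_sup.1 hm'
      obtain ⟨i, hi, rfl⟩ := Submodule.mem_smul_span_singleton.1 hu
      obtain ⟨j, hj, rfl⟩ := Submodule.mem_smul_span_singleton.1 hv
      have hz : (i - t * q) • x' + (j - 1) • y' = 0 := by
        have : (i - t * q) • x' + (j - 1) • y' = (i • x' + j • y') - (y' + (t * q) • x') := by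
          module
        rw [this, huv, sub_self]
      have h3 := (indep hinf' hz).2
      rw [sub_smul, one_smul, sub_eq_zero] at h3
      rw [← h3, hL']
      exact Submodule.mem_sup_right hv
    rw [hcd, memL, hc0] at hyL
    have hd : (psi d).fst = 0 := by
      have := congrArg TrivSqZeroExt.snd hyL
      simpa using this.symm
    rw [hd, mul_zero, add_zero] at f12 f22
    have hb : (psi b).fst = 0 := (mul_eq_zero.1 f12.symm).resolve_left hα
    rw [hb, mul_zero] at f22
    exact one_ne_zero f22

end abstract
end Stmt9Aux

/-- Let `p > 2`, `M ≅ R ⊕ S` with pseudo-basis `(x, y)`, where `x`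
generates a free rank-one `R`-module and `y` generates a copy of the trivial
module `S ≅ R/(1-σ)`, these two summands being complementary. Let `L` be the
`R`-submodule generated by `p·x·e₁ = (1+σ+⋯+σ^{p-1})·x` and `(1-σ)·x + y`.
Then `L ≅ S ⊕ R`, `pM ⊆ L ⊆ M`, the index `[M : L]` is `p²`, and `L` and `M`
admit no compatible pseudo-basis. -/
theorem stmt9 (p : ℕ) [Fact p.Prime] (hp2 : 2 < p)
    (M : Type*) [AddCommGroup M] [Module (Rgrp p) M] (x y : M)
    (hx : LinearMap.ker (LinearMap.toSpanSingleton (Rgrp p) M x) = ⊥)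
    (hy : LinearMap.ker (LinearMap.toSpanSingleton (Rgrp p) M y) =
      Ideal.span {1 - sigmaEl p})
    (hsup : Submodule.span (Rgrp p) {x} ⊔ Submodule.span (Rgrp p) {y} = ⊤)
    (hinf : Submodule.span (Rgrp p) {x} ⊓ Submodule.span (Rgrp p) {y} = ⊥)
    (L : Submodule (Rgrp p) M)
    (hL : L = Submodule.span (Rgrp p) {normEl p • x, (1 - sigmaEl p) • x + y}) :
    Nonempty (L ≃ₗ[Rgrp p]
        (Rgrp p ⧸ Ideal.span {1 - sigmaEl p}) × Rgrp p) ∧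
    Ideal.span {(p : Rgrp p)} • (⊤ : Submodule (Rgrp p) M) ≤ L ∧
    Nat.card (M ⧸ L) = p ^ 2 ∧
    ¬ ∃ (x' y' : M) (I J : Ideal (Rgrp p)),
        LinearMap.ker (LinearMap.toSpanSingleton (Rgrp p) M x') = ⊥ ∧
        LinearMap.ker (LinearMap.toSpanSingleton (Rgrp p) M y') =
          Ideal.span {1 - sigmaEl p} ∧
        Submodule.span (Rgrp p) {x'} ⊔ Submodule.span (Rgrp p) {y'} = ⊤ ∧
        Submodule.span (Rgrp p) {x'} ⊓ Submodule.span (Rgrp p) {y'} = ⊥ ∧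
        L = I • Submodule.span (Rgrp p) {x'} ⊔ J • Submodule.span (Rgrp p) {y'} := by
  exact Stmt9Aux.main p (1 - sigmaEl p) (normEl p) (Stmt9Aux.psi p) (Stmt9Aux.t_N p)
    (Stmt9Aux.ann_t p)
    (fun k h => Stmt9Aux.dvd_of_aug p k (Stmt9Aux.N_inj p k (by
      obtain ⟨w, hw⟩ := h
      rw [hw, map_mul, Stmt9Aux.aug_t, zero_mul])))
    (Stmt9Aux.ker_psi p hp2) (Stmt9Aux.psi_N p hp2) (Stmt9Aux.psi_t p) (Stmt9Aux.psi_surj p)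
    x y hx hy hsup hinf L hL
end

section
/- If L is a ℤ_(p)-lattice in a non-degenerate rational bilinear space with an automorphism σ of order p, and L ≅ R^a ⊕ T^b ⊕ S^c as a ℤ_(p)[σ]-module (where R = ℤ_(p)C_p, T = ℤ_(p)[ζ_p], S = ℤ_(p)), then the dual lattice L^# is also isomorphic to R^a ⊕ T^b ⊕ S^c as a ℤ_(p)[σ]-module. -/
open scoped BigOperators

set_option synthInstance.maxHeartbeats 1000000
set_option maxHeartbeats 1000000

/-- Any `ℚ`-vector space is a module over `ℤ_(p) ⊆ ℚ` by restriction of scalars. -/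
noncomputable instance zsubModule (p : ℕ) [Fact p.Prime] (V : Type*) [AddCommGroup V]
    [Module ℚ V] : Module (Zsub p) V :=
  Module.compHom V (algebraMap (Zsub p) ℚ)

/-- The dual lattice `L^# = {x ∈ V ∣ B(x, ℓ) ∈ ℤ_(p) for all ℓ ∈ L}`. -/
noncomputable def dualLattice (p : ℕ) [Fact p.Prime] {V : Type*} [AddCommGroup V] [Module ℚ V]
    (B : LinearMap.BilinForm ℚ V) (L : Submodule (Zsub p) V) : Submodule (Zsub p) V where
  carrier := {x : V | ∀ l ∈ L, B x l ∈ Zsub p}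
  zero_mem' := by intro l hl; simpa using (Zsub p).zero_mem
  add_mem' := by
    intro a b ha hb l hl
    simpa [map_add] using (Zsub p).add_mem (ha l hl) (hb l hl)
  smul_mem' := by
    intro c x hx l hl
    have : (B ((c : ℚ) • x)) l = (c : ℚ) * B x l := by simp
    show (B ((c : ℚ) • x)) l ∈ Zsub p
    rw [this]
    exact (Zsub p).mul_mem c.2 (hx l hl)

/-- The standard module `R^a ⊕ T^b ⊕ S^c`, with `T = R/(1+σ+⋯+σ^{p-1}) ≅ ℤ_(p)[ζ_p]`
and `S = R/(1-σ) ≅ ℤ_(p)`. -/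
abbrev StdMod (p : ℕ) [Fact p.Prime] (a b c : ℕ) :=
  (Fin a → Rgrp p) × (Fin b → Rgrp p ⧸ Ideal.span {normEl p}) ×
    (Fin c → Rgrp p ⧸ Ideal.span {1 - sigmaEl p})


/-- `M` carries a perfect `σ`-invariant `ℤ_(p)`-bilinear pairing. -/
def SelfDual (p : ℕ) [Fact p.Prime] (M : Type*) [AddCommGroup M] [Module (Zsub p) M]
    [Module (Rgrp p) M] : Prop :=
  ∃ φ : M ≃ₗ[Zsub p] Module.Dual (Zsub p) M,
    ∀ x y, φ (sigmaEl p • x) (sigmaEl p • y) = φ x y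

lemma selfDual_prod (p : ℕ) [Fact p.Prime] {M N : Type*} [AddCommGroup M] [Module (Zsub p) M]
    [Module (Rgrp p) M] [AddCommGroup N] [Module (Zsub p) N]
    [Module (Rgrp p) N] (hM : SelfDual p M) (hN : SelfDual p N) : SelfDual p (M × N) := by
  obtain ⟨f, hf⟩ := hM
  obtain ⟨g, hg⟩ := hN
  refine ⟨(LinearEquiv.prodCongr f g).trans (Module.dualProdDualEquivDual (Zsub p) M N), ?_⟩
  rintro ⟨x, x2⟩ ⟨y, y2⟩
  simp [Module.dualProdDualEquivDual_apply, hf, hg]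

lemma selfDual_pi (p : ℕ) [Fact p.Prime] {M : Type*} [AddCommGroup M] [Module (Zsub p) M]
    [Module (Rgrp p) M] (n : ℕ) (hM : SelfDual p M) : SelfDual p (Fin n → M) := by
  obtain ⟨f, hf⟩ := hM
  refine ⟨(LinearEquiv.piCongrRight (fun _ : Fin n => f)).trans
    (LinearMap.lsum (Zsub p) (fun _ : Fin n => M) (Zsub p)), ?_⟩
  intro x y
  simp [hf]

noncomputable def bet (p : ℕ) [Fact p.Prime] : Rgrp p ≃ₗ[Zsub p] Module.Dual (Zsub p) (Rgrp p) :=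
  (MonoidAlgebra.basis (Cp p) (Zsub p)).toDualEquiv

lemma bet_of (p : ℕ) [Fact p.Prime] (g h : Cp p) :
    bet p (MonoidAlgebra.of (Zsub p) (Cp p) g) (MonoidAlgebra.of (Zsub p) (Cp p) h)
      = if g = h then 1 else 0 := by
  have := (MonoidAlgebra.basis (Cp p) (Zsub p)).toDual_apply g h
  simpa [bet] using this

lemma bet_inv (p : ℕ) [Fact p.Prime] (k : Cp p) (x y : Rgrp p) :
    bet p (MonoidAlgebra.of (Zsub p) (Cp p) k * x) (MonoidAlgebra.of (Zsub p) (Cp p) k * y)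
      = bet p x y := by
  induction x using MonoidAlgebra.induction_on with
  | of g =>
    induction y using MonoidAlgebra.induction_on with
    | of h => rw [← map_mul, ← map_mul, bet_of, bet_of]; simp
    | add a b ha hb => rw [mul_add, map_add, map_add, ha, hb]
    | smul r a ha => rw [mul_smul_comm, map_smul, map_smul, ha]
  | add a b ha hb => rw [mul_add, map_add, map_add, LinearMap.add_apply, LinearMap.add_apply, ha, hb]
  | smul r a ha => rw [mul_smul_comm, map_smul, map_smul, LinearMap.smul_apply, LinearMap.smul_apply, ha]

lemma bet_norm (p : ℕ) [Fact p.Prime] (x y : Rgrp p) :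
    bet p x (normEl p * y) = bet p (normEl p * x) y := by
  unfold normEl
  rw [Finset.sum_mul, Finset.sum_mul, map_sum, map_sum, LinearMap.sum_apply]
  refine Fintype.sum_equiv (Equiv.inv _) _ _ fun g => ?_
  rw [← bet_inv p g⁻¹, ← mul_assoc, ← map_mul, inv_mul_cancel, map_one, one_mul]
  rfl

lemma bet_eq_zero (p : ℕ) [Fact p.Prime] (x : Rgrp p) (h : ∀ y, bet p x y = 0) : x = 0 := by
  apply (bet p).injective
  rw [map_zero]
  exact LinearMap.ext h

lemma orth_norm (p : ℕ) [Fact p.Prime] (z : Rgrp p) :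
    (∀ y, bet p z (normEl p * y) = 0) ↔ normEl p * z = 0 := by
  constructor
  · intro h
    exact bet_eq_zero p _ fun y => by rw [← bet_norm, h]
  · intro h y
    rw [bet_norm, h]; simp

lemma orth_sigma (p : ℕ) [Fact p.Prime] (z : Rgrp p) :
    (∀ y, bet p z ((1 - sigmaEl p) * y) = 0) ↔ (1 - sigmaEl p) * z = 0 := by
  have key : ∀ y, bet p z ((1 - sigmaEl p) * y) = - bet p ((1 - sigmaEl p) * z) (sigmaEl p * y) := by
    intro y
    have := bet_inv p (sigmaGen p) z y
    change bet p (sigmaEl p * z) (sigmaEl p * y) = _ at this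
    simp only [sub_mul, one_mul, map_sub, LinearMap.sub_apply]
    rw [this]; ring
  constructor
  · intro h
    refine bet_eq_zero p _ fun y => ?_
    have h1 := key (MonoidAlgebra.of (Zsub p) (Cp p) (sigmaGen p)⁻¹ * y)
    rw [h, ← mul_assoc, sigmaEl, ← map_mul, mul_inv_cancel, map_one, one_mul] at h1
    exact neg_eq_zero.1 h1.symm
  · intro h y
    rw [key, h]; simp

lemma sigma_pow (p : ℕ) [Fact p.Prime] (g : Cp p) : ∃ n : ℕ, g = sigmaGen p ^ n := by
  refine ⟨(Multiplicative.toAdd g).val, ?_⟩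
  apply Multiplicative.toAdd.injective
  simp [sigmaGen]

lemma of_mul_norm (p : ℕ) [Fact p.Prime] (g : Cp p) :
    MonoidAlgebra.of (Zsub p) (Cp p) g * normEl p = normEl p := by
  unfold normEl
  rw [Finset.mul_sum]
  refine Fintype.sum_equiv (Equiv.mulLeft g) _ _ fun h => ?_
  rw [← map_mul]; rfl

lemma coeff_norm (p : ℕ) [Fact p.Prime] (g : Cp p) : (normEl p).coeff g = 1 := by
  have h : ∀ x : Rgrp p, x.coeff g = (MonoidAlgebra.basis (Cp p) (Zsub p)).coord g x := by
    intro x; rfl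
  rw [h, normEl, map_sum, Finset.sum_eq_single g]
  · rw [← h]; simp
  · intro b _ hb
    rw [← h]; simp [hb]
  · simp

lemma sigma_mul_norm (p : ℕ) [Fact p.Prime] : (1 - sigmaEl p) * normEl p = 0 := by
  rw [sub_mul, one_mul, sigmaEl, of_mul_norm, sub_self]

lemma ann_sigma (p : ℕ) [Fact p.Prime] (x : Rgrp p) :
    (1 - sigmaEl p) * x = 0 ↔ ∃ y, x = normEl p * y := by
  constructor
  · intro h
    rw [sub_mul, one_mul, sub_eq_zero] at h
    have h1 : ∀ g, x.coeff (sigmaGen p * g) = x.coeff g := by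
      intro g
      conv_lhs => rw [h, sigmaEl, MonoidAlgebra.of_apply, MonoidAlgebra.coeff_single_mul_apply]
      simp
    have h2 : ∀ n : ℕ, x.coeff (sigmaGen p ^ n) = x.coeff 1 := by
      intro n
      induction n with
      | zero => simp
      | succ n ih => rw [pow_succ', h1, ih]
    refine ⟨x.coeff 1 • 1, ?_⟩
    rw [mul_smul_comm, mul_one]
    ext g
    obtain ⟨n, rfl⟩ := sigma_pow p g
    rw [h2, MonoidAlgebra.coeff_smul_apply, coeff_norm]
    simp
  · rintro ⟨y, rfl⟩
    rw [← mul_assoc, sigma_mul_norm, zero_mul]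

lemma ann_norm (p : ℕ) [Fact p.Prime] (x : Rgrp p) :
    normEl p * x = 0 ↔ ∃ y, x = (1 - sigmaEl p) * y := by
  constructor
  · intro h
    have key : ∀ x : Rgrp p, ∃ c : Zsub p, ∃ y, x = c • 1 + (1 - sigmaEl p) * y := by
      intro x
      induction x using MonoidAlgebra.induction_on with
      | of g =>
        obtain ⟨n, rfl⟩ := sigma_pow p g
        obtain ⟨y, hy⟩ := sub_dvd_pow_sub_pow (1 : Rgrp p) (sigmaEl p) n
        refine ⟨1, -y, ?_⟩
        rw [map_pow, one_smul]
        change sigmaEl p ^ n = _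
        rw [one_pow] at hy
        linear_combination -hy
      | add a b ha hb =>
        obtain ⟨c, y, h⟩ := ha
        obtain ⟨d, z, h'⟩ := hb
        refine ⟨c + d, y + z, ?_⟩
        rw [h, h', add_smul, mul_add]; abel
      | smul r a ha =>
        obtain ⟨c, y, h⟩ := ha
        refine ⟨r * c, r • y, ?_⟩
        rw [h, smul_add, mul_smul, mul_smul_comm]
    obtain ⟨c, y, rfl⟩ := key x
    rw [mul_add, ← mul_assoc, mul_comm (normEl p) (1 - _), sigma_mul_norm, zero_mul, add_zero,
      mul_smul_comm, mul_one] at h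
    have hc : c = 0 := by
      have := congrArg (fun z : Rgrp p => z.coeff 1) h
      simpa [coeff_norm] using this
    exact ⟨y, by rw [hc, zero_smul, zero_add]⟩
  · rintro ⟨y, rfl⟩
    rw [← mul_assoc, mul_comm (normEl p), sigma_mul_norm, zero_mul]

lemma selfDual_quot_aux {Z A : Type*} [CommRing Z] [CommRing A] [Algebra Z A]
    (β : A ≃ₗ[Z] Module.Dual Z A) (s : A) (hs : ∀ x y, β (s * x) (s * y) = β x y) (u v : A)
    (h1 : ∀ z, (∀ y, β z (v * y) = 0) ↔ v * z = 0)
    (h2 : ∀ x, v * x = 0 ↔ ∃ y, x = u * y)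
    (h3 : ∀ x, u * x = 0 ↔ ∃ y, x = v * y) :
    ∃ φ : (A ⧸ Ideal.span {v}) ≃ₗ[Z] Module.Dual Z (A ⧸ Ideal.span {v}),
      ∀ x y, φ (s • x) (s • y) = φ x y := by
  let q : A →ₗ[Z] (A ⧸ Ideal.span {v}) :=
    (Submodule.mkQ (Ideal.span {v})).restrictScalars (Z)
  have hq : ∀ y, q y = Ideal.Quotient.mk _ y := fun y => rfl
  have hqs : Function.Surjective q := fun x => (Ideal.Quotient.mk_surjective x).imp fun y hy => (hq y).trans hy
  have hqv : ∀ y, q (v * y) = 0 := by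
    intro y
    rw [hq, Ideal.Quotient.eq_zero_iff_mem, Ideal.mem_span_singleton]
    exact dvd_mul_right _ _
  let ρ : Module.Dual (Z) (A ⧸ Ideal.span {v}) →ₗ[Z] A :=
    (β).symm.toLinearMap.comp q.dualMap
  have hρ : ∀ f y, β (ρ f) y = f (q y) := by
    intro f y
    simp [ρ]
  have hρi : Function.Injective ρ :=
    (β).symm.injective.comp (LinearMap.dualMap_injective_of_surjective hqs)
  let μ0 : (A ⧸ Ideal.span {v}) →ₗ[A] A :=
    Submodule.liftQ _ (LinearMap.mulLeft (A) u) (by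
      intro z hz
      obtain ⟨y, rfl⟩ := Ideal.mem_span_singleton.1 hz
      exact (h3 _).2 ⟨y, rfl⟩)
  let μ : (A ⧸ Ideal.span {v}) →ₗ[Z] A := μ0.restrictScalars (Z)
  have hμ : ∀ y, μ (q y) = u * y := fun y => rfl
  have hμs : ∀ (r : A) x, μ (r • x) = r * μ x := fun r x => μ0.map_smul r x
  have hμi : Function.Injective μ := by
    rw [injective_iff_map_eq_zero]
    intro x hx
    obtain ⟨y, rfl⟩ := hqs x
    rw [hμ, h3] at hx
    obtain ⟨w, rfl⟩ := hx
    exact hqv w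
  have hr : LinearMap.range μ = LinearMap.range ρ := by
    ext z
    trans v * z = 0
    · rw [h2]
      constructor
      · rintro ⟨x, rfl⟩
        obtain ⟨y, rfl⟩ := hqs x
        exact ⟨y, hμ y⟩
      · rintro ⟨y, rfl⟩
        exact ⟨q y, hμ y⟩
    · rw [← h1]
      constructor
      · intro h
        have hf : ∃ f : Module.Dual (Z) (A ⧸ Ideal.span {v}), f.comp q = β z := by
          refine ⟨Submodule.liftQ ((Ideal.span {v}).restrictScalars (Z)) (β z) ?_, ?_⟩
          · intro w hw
            obtain ⟨y, rfl⟩ := Ideal.mem_span_singleton.1 hw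
            exact h y
          · ext y; rfl
        obtain ⟨f, hf⟩ := hf
        refine ⟨f, (β).injective (LinearMap.ext fun y => ?_)⟩
        rw [hρ, ← hf]; rfl
      · rintro ⟨f, rfl⟩ y
        rw [hρ, hqv, map_zero]
  let φ := (LinearEquiv.ofInjective μ hμi).trans
    ((LinearEquiv.ofEq _ _ hr).trans (LinearEquiv.ofInjective ρ hρi).symm)
  have hφ : ∀ x, ρ (φ x) = μ x := by
    intro x
    have : (LinearEquiv.ofInjective ρ hρi) (φ x) =
      (LinearEquiv.ofEq _ _ hr) (LinearEquiv.ofInjective μ hμi x) := by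
      simp [φ]
    exact congrArg Subtype.val this
  refine ⟨φ, fun x y => ?_⟩
  obtain ⟨y, rfl⟩ := hqs y
  have e1 : s • q y = q (s * y) := rfl
  rw [e1, ← hρ, ← hρ, hφ, hφ, hμs]
  exact hs _ _

lemma selfDual_quot (p : ℕ) [Fact p.Prime] (u v : Rgrp p)
    (h1 : ∀ z, (∀ y, bet p z (v * y) = 0) ↔ v * z = 0)
    (h2 : ∀ x, v * x = 0 ↔ ∃ y, x = u * y)
    (h3 : ∀ x, u * x = 0 ↔ ∃ y, x = v * y) :
    SelfDual p (Rgrp p ⧸ Ideal.span {v}) := by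
  exact selfDual_quot_aux (bet p) (sigmaEl p) (bet_inv p _) u v h1 h2 h3

lemma selfDual_std (p : ℕ) [Fact p.Prime] (a b c : ℕ) : SelfDual p (StdMod p a b c) := by
  refine selfDual_prod p (selfDual_pi p a ⟨bet p, bet_inv p _⟩)
    (selfDual_prod p (selfDual_pi p b ?_) (selfDual_pi p c ?_))
  · exact selfDual_quot p (1 - sigmaEl p) (normEl p) (orth_norm p) (ann_norm p) (ann_sigma p)
  · exact selfDual_quot p (normEl p) (1 - sigmaEl p) (orth_sigma p) (ann_sigma p) (ann_norm p)

/-- Additive functionals on a full subgroup extend. -/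
lemma extend_full (p : ℕ) [Fact p.Prime] {V : Type*} [AddCommGroup V] [Module ℚ V]
    [FiniteDimensional ℚ V] (L : Submodule (Zsub p) V)
    (hfull : Submodule.span ℚ (L : Set V) = ⊤) (f : L →+ ℚ) :
    ∃ F : V →ₗ[ℚ] ℚ, ∀ l : L, F l = f l := by
  let b := Module.Basis.ofSpan hfull.ge
  have hb : ∀ i, b i ∈ L := fun i => Module.Basis.ofSpan_subset hfull.ge ⟨i, rfl⟩
  haveI : Fintype _ := FiniteDimensional.fintypeBasisIndex b
  let F : V →ₗ[ℚ] ℚ := b.constr ℚ (fun i => f ⟨b i, hb i⟩)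
  have hF : ∀ i, F (b i) = f ⟨b i, hb i⟩ := fun i => b.constr_basis ℚ _ i
  refine ⟨F, fun l => ?_⟩
  obtain ⟨n, hn⟩ := IsLocalization.exist_integer_multiples_of_finset (nonZeroDivisors ℤ)
    (Finset.univ.image (fun i => b.repr (l : V) i))
  have hn' : ∀ i, ∃ m : ℤ, (m : ℚ) = (n : ℤ) * b.repr (l : V) i := by
    intro i
    obtain ⟨m, hm⟩ := hn _ (Finset.mem_image_of_mem _ (Finset.mem_univ i))
    exact ⟨m, by simpa using hm⟩
  choose m hm using hn'
  have hn0 : ((n : ℤ) : ℚ) ≠ 0 := by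
    exact_mod_cast nonZeroDivisors.ne_zero n.2
  have hl : (n : ℤ) • l = ∑ i, m i • (⟨b i, hb i⟩ : L) := by
    apply Subtype.ext
    have h3 : (((n : ℤ) • l : L) : V) = (n : ℤ) • (l : V) := L.subtype.toAddMonoidHom.map_zsmul _ _
    have h4 : ((∑ i, m i • (⟨b i, hb i⟩ : L) : L) : V) = ∑ i, m i • b i := by
      have := map_sum L.subtype.toAddMonoidHom (fun i => m i • (⟨b i, hb i⟩ : L)) Finset.univ
      refine this.trans (Finset.sum_congr rfl fun i _ => ?_)
      exact L.subtype.toAddMonoidHom.map_zsmul _ _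
    rw [h3, h4]
    conv_lhs => rw [← b.sum_repr (l : V)]
    rw [Finset.smul_sum]
    refine Finset.sum_congr rfl fun i _ => ?_
    rw [← Int.cast_smul_eq_zsmul ℚ, ← Int.cast_smul_eq_zsmul ℚ, hm, mul_smul]
  have e1 : ((n : ℤ) : ℚ) * f l = ∑ i, (m i : ℚ) * f ⟨b i, hb i⟩ := by
    have := congrArg f hl
    rw [map_zsmul, map_sum, zsmul_eq_mul] at this
    rw [this]
    refine Finset.sum_congr rfl fun i _ => ?_
    rw [map_zsmul, zsmul_eq_mul]
  have e2 : ((n : ℤ) : ℚ) * F l = ∑ i, (m i : ℚ) * f ⟨b i, hb i⟩ := by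
    conv_lhs => rw [← b.sum_repr (l : V)]
    rw [map_sum, Finset.mul_sum]
    refine Finset.sum_congr rfl fun i _ => ?_
    rw [map_smul, hF, hm, smul_eq_mul, mul_assoc]
  exact mul_left_cancel₀ hn0 (e2.trans e1.symm)

/-- If a `σ`-invariant lattice `L` in a non-degenerate rational
bilinear space is isomorphic to `R^a ⊕ T^b ⊕ S^c` as a `ℤ_(p)[σ]`-module
(i.e. there is a `ℤ_(p)`-linear isomorphism intertwining `σ` with
multiplication by `σ`), then the dual lattice `L^#` is `σ`-invariant and also
isomorphic to `R^a ⊕ T^b ⊕ S^c` as a `ℤ_(p)[σ]`-module. -/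
theorem stmt11 (p : ℕ) [Fact p.Prime] (a b c : ℕ)
    (V : Type*) [AddCommGroup V] [Module ℚ V] [FiniteDimensional ℚ V]
    (B : LinearMap.BilinForm ℚ V) (hBsymm : ∀ x y : V, B x y = B y x)
    (hBnd : B.Nondegenerate)
    (σ : V ≃ₗ[ℚ] V) (hiso : ∀ x y : V, B (σ x) (σ y) = B x y)
    (hord : σ ^ p = 1) (hne : σ ≠ 1)
    (L : Submodule (Zsub p) V)
    (hfull : Submodule.span ℚ (L : Set V) = ⊤)
    (hσL : ∀ x : V, x ∈ L ↔ σ x ∈ L)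
    (hLiso : ∃ e : L ≃ₗ[Zsub p] StdMod p a b c,
      ∀ (x : V) (hx : x ∈ L),
        e ⟨σ x, (hσL x).mp hx⟩ = sigmaEl p • e ⟨x, hx⟩) :
    ∃ hinv : ∀ x ∈ dualLattice p B L, σ x ∈ dualLattice p B L,
      ∃ e : (dualLattice p B L) ≃ₗ[Zsub p] StdMod p a b c,
        ∀ (x : V) (hx : x ∈ dualLattice p B L),
          e ⟨σ x, hinv x hx⟩ = sigmaEl p • e ⟨x, hx⟩ := by
  obtain ⟨e, he⟩ := hLiso
  obtain ⟨φ, hφ⟩ := selfDual_std p a b c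
  have hsymm : ∀ l ∈ L, σ.symm l ∈ L := by
    intro l hl
    rw [hσL]; simpa using hl
  have hinv : ∀ x ∈ dualLattice p B L, σ x ∈ dualLattice p B L := by
    intro x hx l hl
    have := hx _ (hsymm l hl)
    rw [← hiso] at this
    simpa using this
  refine ⟨hinv, ?_⟩
  let D : dualLattice p B L →ₗ[Zsub p] Module.Dual (Zsub p) L :=
    { toFun := fun x =>
        { toFun := fun l => ⟨B x l, x.2 l l.2⟩
          map_add' := by
            intro l m
            apply Subtype.ext
            exact (B (x : V)).map_add _ _
          map_smul' := by
            intro r l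
            apply Subtype.ext
            exact (B (x : V)).map_smul (r : ℚ) (l : V) }
      map_add' := by
        intro x y
        refine LinearMap.ext fun l => Subtype.ext ?_
        exact LinearMap.congr_fun (B.map_add (x : V) (y : V)) (l : V)
      map_smul' := by
        intro r x
        refine LinearMap.ext fun l => Subtype.ext ?_
        exact LinearMap.congr_fun (B.map_smul (r : ℚ) (x : V)) (l : V) }
  have hD : ∀ x l, ((D x l : Zsub p) : ℚ) = B x l := fun x l => rfl
  have hDi : Function.Injective D := by
    intro x y hxy
    apply Subtype.ext
    apply (B.toDual hBnd).injective
    apply LinearMap.ext_on hfull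
    intro l hl
    have := congrArg Subtype.val (LinearMap.congr_fun hxy ⟨l, hl⟩)
    exact this
  have hDs : Function.Surjective D := by
    intro f
    obtain ⟨F, hF⟩ := extend_full p L hfull
      ((Zsub p).subtype.toAddMonoidHom.comp f.toAddMonoidHom)
    have hB : ∀ l : L, B ((B.toDual hBnd).symm F) l = (f l : ℚ) := by
      intro l
      rw [LinearMap.BilinForm.apply_toDual_symm_apply, hF]; rfl
    refine ⟨⟨(B.toDual hBnd).symm F, ?_⟩, ?_⟩
    · intro l hl
      rw [hB ⟨l, hl⟩]
      exact (f ⟨l, hl⟩).2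
    · refine LinearMap.ext fun l => Subtype.ext ?_
      exact hB l
  let E := LinearEquiv.ofBijective D ⟨hDi, hDs⟩
  let G := (E.trans e.symm.dualMap).trans φ.symm
  have hG : ∀ x l, φ (G x) (e l) = D x l := by
    intro x l
    simp [G, E]
    rfl
  refine ⟨G, fun x hx => ?_⟩
  apply φ.injective
  refine LinearMap.ext fun m => ?_
  obtain ⟨l, rfl⟩ := e.surjective m
  have hl : e l = sigmaEl p • e ⟨σ.symm l, hsymm l l.2⟩ := by
    rw [← he]
    congr 1
    apply Subtype.ext
    simp
  rw [hG, hl, hφ, hG]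
  apply Subtype.ext
  rw [hD, hD]
  change B (σ x) l = B x (σ.symm l)
  rw [← hiso x]; simp
end
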